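/- Let K be a cell with volume |K| > 0, let ρ > 0 and δt > 0, let E(K) be a finite set of faces with fluxes F_σ ∈ ℝ, and let S ≥ 0 be a slope bound. Let y_K ∈ ℝ and, for each σ ∈ E(K), a face value y_σ ∈ ℝ, a coefficient α_σ ∈ [0,1] and a neighbour value w_σ ∈ ℝ such that y_σ − y_K = α_σ S (y_K − w_σ) whenever F_σ ≥ 0, and y_σ − y_K = α_σ (w_σ − y_K) whenever F_σ < 0. Define y'_K = y_K − (δt/(|K| ρ)) Σ_{σ∈E(K)} F_σ (y_σ − y_K). If (δt/(|K| ρ)) ( S Σ_{σ: F_σ≥0} α_σ |F_σ| + Σ_{σ: F_σ<0} α_σ |F_σ| ) ≤ 1, then y'_K = (1 − Σ_σ μ_σ) y_K + Σ_σ μ_σ w_σ with μ_σ ≥ 0 and Σ_σ μ_σ ≤ 1; in particular min(y_K, min_σ w_σ) ≤ y'_K ≤ max(y_K, max_σ w_σ), i.e. the downwind-limited transport scheme with slope bound S_max = S satisfies a discrete maximum principle for small enough time steps. -/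

import Mathlib

/-- discrete maximum principle for the modified downwind-limited
transport scheme with slope bound `S_max = S`: under the stated CFL-like condition the
updated value is a convex combination of the cell value and the neighbour values. -/
theorem downwind_limited_transport_maximum_principle {F : Type*}
    (volK ρ δt S : ℝ) (hvolK : 0 < volK) (hρ : 0 < ρ) (hδt : 0 < δt) (hS : 0 ≤ S)
    (E : Finset F) (flux : F → ℝ)
    (yK : ℝ) (yσ α w : F → ℝ)
    (hα : ∀ σ ∈ E, α σ ∈ Set.Icc (0:ℝ) 1)
    (hlim : ∀ σ ∈ E, (0 ≤ flux σ → yσ σ - yK = α σ * S * (yK - w σ))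
                   ∧ (flux σ < 0 → yσ σ - yK = α σ * (w σ - yK)))
    (y' : ℝ)
    (hy' : y' = yK - (δt / (volK * ρ)) * ∑ σ ∈ E, flux σ * (yσ σ - yK))
    (hCFL : (δt / (volK * ρ)) *
        ((∑ σ ∈ E with 0 ≤ flux σ, S * α σ * |flux σ|)
          + ∑ σ ∈ E with flux σ < 0, α σ * |flux σ|) ≤ 1) :
    ∃ μ : F → ℝ,
      (∀ σ ∈ E, 0 ≤ μ σ) ∧ (∑ σ ∈ E, μ σ) ≤ 1
      ∧ y' = (1 - ∑ σ ∈ E, μ σ) * yK + ∑ σ ∈ E, μ σ * w σ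
      ∧ (insert yK (E.image w)).min' (Finset.insert_nonempty _ _) ≤ y'
      ∧ y' ≤ (insert yK (E.image w)).max' (Finset.insert_nonempty _ _) := by
  set c := δt / (volK * ρ) with hc
  have hc0 : 0 ≤ c := by positivity
  let μ : F → ℝ := fun σ => c * (if 0 ≤ flux σ then S * α σ * |flux σ| else α σ * |flux σ|)
  have hμ0 : ∀ σ ∈ E, 0 ≤ μ σ := by
    intro σ hσ
    have h1 := (hα σ hσ).1
    simp only [μ]
    split_ifs <;> positivity
  have hμ1 : ∑ σ ∈ E, μ σ ≤ 1 := by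
    simp only [μ]
    rw [← Finset.mul_sum, Finset.sum_ite]
    simpa only [not_le] using hCFL
  have hdiff : ∀ σ ∈ E, c * (flux σ * (yσ σ - yK)) = μ σ * yK - μ σ * w σ := by
    intro σ hσ
    simp only [μ]
    split_ifs with h
    · rw [(hlim σ hσ).1 h, abs_of_nonneg h]; ring
    · rw [(hlim σ hσ).2 (not_le.mp h), abs_of_neg (not_le.mp h)]; ring
  have hy : y' = (1 - ∑ σ ∈ E, μ σ) * yK + ∑ σ ∈ E, μ σ * w σ := by
    rw [hy', Finset.mul_sum, Finset.sum_congr rfl hdiff, Finset.sum_sub_distrib,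
      ← Finset.sum_mul]
    ring
  refine ⟨μ, hμ0, hμ1, hy, ?_, ?_⟩
  · set m := (insert yK (E.image w)).min' (Finset.insert_nonempty _ _) with hm
    have hK : m ≤ yK := Finset.min'_le _ _ (Finset.mem_insert_self _ _)
    have hw : ∀ σ ∈ E, m ≤ w σ := fun σ hσ =>
      Finset.min'_le _ _ (Finset.mem_insert_of_mem (Finset.mem_image_of_mem w hσ))
    have h1 : (∑ σ ∈ E, μ σ) * m ≤ ∑ σ ∈ E, μ σ * w σ := by
      rw [Finset.sum_mul]
      exact Finset.sum_le_sum fun σ hσ => mul_le_mul_of_nonneg_left (hw σ hσ) (hμ0 σ hσ)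
    have h2 := mul_le_mul_of_nonneg_left hK (sub_nonneg.mpr hμ1)
    rw [hy]; linarith
  · set m := (insert yK (E.image w)).max' (Finset.insert_nonempty _ _) with hm
    have hK : yK ≤ m := Finset.le_max' _ _ (Finset.mem_insert_self _ _)
    have hw : ∀ σ ∈ E, w σ ≤ m := fun σ hσ =>
      Finset.le_max' _ _ (Finset.mem_insert_of_mem (Finset.mem_image_of_mem w hσ))
    have h1 : ∑ σ ∈ E, μ σ * w σ ≤ (∑ σ ∈ E, μ σ) * m := by
      rw [Finset.sum_mul]
      exact Finset.sum_le_sum fun σ hσ => mul_le_mul_of_nonneg_left (hw σ hσ) (hμ0 σ hσ)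
    have h2 := mul_le_mul_of_nonneg_left hK (sub_nonneg.mpr hμ1)
    rw [hy]; linarith
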